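/- arXiv:2605.13397 — 5 statements merged into one kernel-verified Lean document; each statement's English description precedes it below -/
import Mathlib

section
/- Under power-law decaying sampling probabilities p_t = t^{-λ} / Σ_{j=1}^T j^{-λ} with λ > 1, if |e_t| ≤ C T^{-3/2} for all t and some constant C > 0, then the variance of the weighted difference estimator satisfies Var(ℓ̂) ≤ (ζ(λ) C² / m) T^{λ−2}, where ζ(λ) = Σ_{j=1}^∞ j^{-λ}. -/
/-- Splitting off the first draw in a sum over tuples with product weights. -/
lemma sum_prod_weights_mul_fin_succ {α : Type*} [Fintype α] (w : α → ℝ) (n : ℕ)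
    (F : (Fin (n + 1) → α) → ℝ) :
    ∑ u : Fin (n + 1) → α, (∏ i, w (u i)) * F u =
      ∑ a, ∑ u : Fin n → α, w a * (∏ i, w (u i)) * F (Fin.cons a u) := by
  rw [← (Fin.consEquiv fun _ : Fin (n + 1) => α).sum_comp, Fintype.sum_prod_type]
  simp [Fin.consEquiv, Fin.prod_univ_succ]

/-- Product weights built from a probability vector have total mass one. -/
lemma sum_prod_weights_eq_one {α : Type*} [Fintype α] (w : α → ℝ) (hw : ∑ a, w a = 1) (n : ℕ) :
    ∑ u : Fin n → α, ∏ i, w (u i) = 1 := by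
  induction n with
  | zero => simp
  | succ n ih =>
    have h := sum_prod_weights_mul_fin_succ w n fun _ => 1
    simp only [mul_one] at h
    simp only [h, ← Finset.mul_sum, ih, mul_one, hw]

/-- A sum of i.i.d. centered variables is centered. -/
lemma sum_prod_weights_mul_sum_eq_zero {α : Type*} [Fintype α] (w h : α → ℝ)
    (hw : ∑ a, w a = 1) (hh : ∑ a, w a * h a = 0) (n : ℕ) :
    ∑ u : Fin n → α, (∏ i, w (u i)) * ∑ i, h (u i) = 0 := by
  induction n with
  | zero => simp
  | succ n ih =>
    rw [sum_prod_weights_mul_fin_succ]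
    simp only [Fin.sum_univ_succ, Fin.cons_zero, Fin.cons_succ]
    calc _ = ∑ a, (w a * h a * (∑ u : Fin n → α, ∏ i, w (u i)) +
          w a * ∑ u : Fin n → α, (∏ i, w (u i)) * ∑ i, h (u i)) := by
          refine Finset.sum_congr rfl fun a _ => ?_
          rw [Finset.mul_sum, Finset.mul_sum, ← Finset.sum_add_distrib]
          exact Finset.sum_congr rfl fun u _ => by ring
      _ = 0 := by simp [ih, sum_prod_weights_eq_one w hw, hh]

/-- The second moment of a sum of i.i.d. centered variables. -/
lemma sum_prod_weights_mul_sum_sq {α : Type*} [Fintype α] (w h : α → ℝ)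
    (hw : ∑ a, w a = 1) (hh : ∑ a, w a * h a = 0) (n : ℕ) :
    ∑ u : Fin n → α, (∏ i, w (u i)) * (∑ i, h (u i)) ^ 2 = n * ∑ a, w a * h a ^ 2 := by
  induction n with
  | zero => simp
  | succ n ih =>
    rw [sum_prod_weights_mul_fin_succ]
    simp only [Fin.sum_univ_succ, Fin.cons_zero, Fin.cons_succ]
    calc _ = ∑ a, (w a * h a ^ 2 * (∑ u : Fin n → α, ∏ i, w (u i)) +
          2 * (w a * h a) * (∑ u : Fin n → α, (∏ i, w (u i)) * ∑ i, h (u i)) +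
          w a * ∑ u : Fin n → α, (∏ i, w (u i)) * (∑ i, h (u i)) ^ 2) := by
          refine Finset.sum_congr rfl fun a _ => ?_
          rw [Finset.mul_sum, Finset.mul_sum, Finset.mul_sum, ← Finset.sum_add_distrib,
            ← Finset.sum_add_distrib]
          exact Finset.sum_congr rfl fun u _ => by ring
      _ = _ := by
          simp only [sum_prod_weights_mul_sum_eq_zero w h hw hh, sum_prod_weights_eq_one w hw, ih,
            mul_one, mul_zero, add_zero, Finset.sum_add_distrib, ← Finset.sum_mul, hw, one_mul]
          push_cast
          ring

/-- Under power-law decaying sampling probabilities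
`p_t = t^{-λ} / Σ_{j=1}^T j^{-λ}` with `λ > 1`, if `|e_t| ≤ C T^{-3/2}` for all
`t` and some `C > 0`, then the variance of the weighted difference estimator
satisfies `Var(ℓ̂) ≤ (ζ(λ) C²/m) T^{λ−2}`, where `ζ(λ) = Σ_{j=1}^∞ j^{-λ}`.
The index `t : Fin T` corresponds to the time point `t.val + 1 ∈ {1,…,T}`. -/
theorem variance_bound_powerlaw_sampling
    (T m : ℕ) (hT : 1 ≤ T) (hm : 1 ≤ m)
    (lam : ℝ) (hlam : 1 < lam)
    (ℓ q p : Fin T → ℝ)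
    (hp : ∀ t : Fin T, p t = ((t.val : ℝ) + 1) ^ (-lam) /
        ∑ j : Fin T, ((j.val : ℝ) + 1) ^ (-lam))
    (e : Fin T → ℝ) (he : ∀ t, e t = ℓ t - q t)
    (C : ℝ) (hC : 0 < C)
    (hbound : ∀ t, |e t| ≤ C * (T : ℝ) ^ (-(3 : ℝ) / 2))
    (z : ℝ) (hz : z = ∑' j : ℕ, ((j : ℝ) + 1) ^ (-lam))
    (est : (Fin m → Fin T) → ℝ)
    (hest : ∀ u, est u =
      (∑ t, q t) + (1 / (m : ℝ)) * ∑ i, (ℓ (u i) - q (u i)) / p (u i))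
    (μ V : ℝ)
    (hμ : μ = ∑ u : Fin m → Fin T, (∏ i, p (u i)) * est u)
    (hV : V = ∑ u : Fin m → Fin T, (∏ i, p (u i)) * (est u - μ) ^ 2) :
    V ≤ z * C ^ 2 / (m : ℝ) * (T : ℝ) ^ (lam - 2) := by
  have : Nonempty (Fin T) := ⟨⟨0, hT⟩⟩
  have hm0 : (m : ℝ) ≠ 0 := by positivity
  have hT0 : (0 : ℝ) < T := by positivity
  set S := ∑ j : Fin T, ((j.val : ℝ) + 1) ^ (-lam) with hS
  have hSpos : 0 < S := Finset.sum_pos (fun j _ => by positivity) Finset.univ_nonempty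
  have hSz : S ≤ z := by
    have hsum : Summable fun j : ℕ => ((j : ℝ) + 1) ^ (-lam) := by
      have h := (summable_nat_add_iff 1).2 (Real.summable_nat_rpow.2 (neg_lt_neg hlam))
      simpa using h
    rw [hz, hS, Fin.sum_univ_eq_sum_range (fun j : ℕ => ((j : ℝ) + 1) ^ (-lam)) T]
    exact hsum.sum_le_tsum _ fun j _ => by positivity
  have hppos : ∀ t, 0 < p t := fun t => by rw [hp]; positivity
  have hpsum : ∑ t, p t = 1 := by
    simp only [hp, ← Finset.sum_div]
    exact div_self hSpos.ne'
  set E := ∑ t, e t with hE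
  set h : Fin T → ℝ := fun t => e t / p t - E with hh_def
  have hcenter : ∑ t, p t * h t = 0 := by
    have h1 : ∀ t, p t * h t = e t - p t * E := fun t => by
      have := (hppos t).ne'
      simp only [hh_def]
      field_simp
    simp only [h1, Finset.sum_sub_distrib, ← Finset.sum_mul, hpsum, one_mul, ← hE, sub_self]
  have hest' : ∀ u, est u = (∑ t, q t) + E + (1 / (m : ℝ)) * ∑ i, h (u i) := fun u => by
    rw [hest]
    simp only [hh_def, he, Finset.sum_sub_distrib, Finset.sum_const, Finset.card_univ,
      Fintype.card_fin, nsmul_eq_mul]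
    field_simp
    ring
  have hmean : μ = (∑ t, q t) + E := by
    rw [hμ]
    calc _ = (∑ u : Fin m → Fin T, ∏ i, p (u i)) * ((∑ t, q t) + E) +
          (1 / (m : ℝ)) * ∑ u : Fin m → Fin T, (∏ i, p (u i)) * ∑ i, h (u i) := by
          rw [Finset.sum_mul, Finset.mul_sum, ← Finset.sum_add_distrib]
          exact Finset.sum_congr rfl fun u _ => by rw [hest']; ring
      _ = _ := by
          rw [sum_prod_weights_eq_one p hpsum, sum_prod_weights_mul_sum_eq_zero p h hpsum hcenter]
          ring
  have hvar : V = (1 / (m : ℝ)) * ∑ t, p t * h t ^ 2 := by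
    rw [hV]
    calc _ = (1 / (m : ℝ)) ^ 2 * ∑ u : Fin m → Fin T, (∏ i, p (u i)) * (∑ i, h (u i)) ^ 2 := by
          rw [Finset.mul_sum]
          exact Finset.sum_congr rfl fun u _ => by rw [hest', hmean]; ring
      _ = _ := by
          rw [sum_prod_weights_mul_sum_sq p h hpsum hcenter]
          field_simp
  have hsecond : ∑ t, p t * h t ^ 2 = ∑ t, e t ^ 2 / p t - E ^ 2 := by
    have h1 : ∀ t, p t * h t ^ 2 = e t ^ 2 / p t - 2 * E * e t + p t * E ^ 2 := fun t => by
      have := (hppos t).ne'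
      simp only [hh_def]
      field_simp
      ring
    simp only [h1, Finset.sum_add_distrib, Finset.sum_sub_distrib, ← Finset.mul_sum,
      ← Finset.sum_mul, hpsum, ← hE]
    ring
  have hterm : ∀ t, e t ^ 2 / p t ≤ C ^ 2 * (T : ℝ) ^ (-3 : ℝ) * ((T : ℝ) ^ lam * S) := fun t => by
    have h1 : e t ^ 2 ≤ C ^ 2 * (T : ℝ) ^ (-3 : ℝ) := by
      calc e t ^ 2 = |e t| ^ 2 := (sq_abs _).symm
        _ ≤ (C * (T : ℝ) ^ (-(3 : ℝ) / 2)) ^ 2 := by gcongr; exact hbound t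
        _ = _ := by
          rw [mul_pow, ← Real.rpow_natCast ((T : ℝ) ^ _) 2, ← Real.rpow_mul hT0.le]
          norm_num
    have h2 : (p t)⁻¹ ≤ (T : ℝ) ^ lam * S := by
      rw [hp, inv_div, Real.rpow_neg (by positivity), div_inv_eq_mul, mul_comm]
      have h3 : (t.val : ℝ) + 1 ≤ T := by exact_mod_cast t.isLt
      gcongr
    rw [div_eq_mul_inv]
    have := hppos t
    gcongr
  have htotal : ∑ t, e t ^ 2 / p t ≤ z * C ^ 2 * (T : ℝ) ^ (lam - 2) := by
    calc ∑ t, e t ^ 2 / p t ≤ ∑ _t : Fin T, C ^ 2 * (T : ℝ) ^ (-3 : ℝ) * ((T : ℝ) ^ lam * S) :=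
          Finset.sum_le_sum fun t _ => hterm t
      _ = S * C ^ 2 * (T : ℝ) ^ (lam - 2) := by
          have h1 : (T : ℝ) ^ (lam - 2) = T * (T : ℝ) ^ (-3 : ℝ) * (T : ℝ) ^ lam := by
            nth_rewrite 2 [← Real.rpow_one (T : ℝ)]
            rw [← Real.rpow_add hT0, ← Real.rpow_add hT0]
            ring_nf
          rw [h1, Finset.sum_const, Finset.card_univ, Fintype.card_fin, nsmul_eq_mul]
          ring
      _ ≤ _ := by gcongr
  calc V ≤ (1 / (m : ℝ)) * (z * C ^ 2 * (T : ℝ) ^ (lam - 2)) := by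
        rw [hvar, hsecond]
        gcongr
        linarith [sq_nonneg E]
    _ = _ := by ring
end

section
/- Under exponentially decaying sampling probabilities p_t = exp(−κt) / Σ_{j=1}^T exp(−κj) with κ > 0, if |e_t| ≤ C T^{-3/2} for all t and some constant C > 0, then the variance of the weighted difference estimator satisfies Var(ℓ̂) ≤ (C² e^κ / (m (e^κ − 1)²)) · exp(κT) · T^{-3}. -/
/-- Sums over tuples of length `m + 1` split into the head and the tail. -/
theorem sum_fin_succ_pi {ι : Type*} [Fintype ι] (m : ℕ) (F : (Fin (m + 1) → ι) → ℝ) :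
    ∑ u, F u = ∑ a, ∑ u : Fin m → ι, F (Fin.cons a u) := by
  rw [← (Fin.consEquiv fun _ : Fin (m + 1) => ι).sum_comp, Fintype.sum_prod_type]
  rfl

/-- Mean of a shifted i.i.d. sum under the product weights. -/
theorem sum_prod_mul_add_sum {ι : Type*} [Fintype ι] (p f : ι → ℝ) (hp : ∑ t, p t = 1)
    (m : ℕ) (c : ℝ) :
    ∑ u : Fin m → ι, (∏ i, p (u i)) * (c + ∑ i, f (u i)) = c + m * ∑ t, p t * f t := by
  induction m generalizing c with
  | zero => simp
  | succ m ih =>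
    rw [sum_fin_succ_pi]
    simp only [Fin.prod_univ_succ, Fin.sum_univ_succ, Fin.cons_zero, Fin.cons_succ, mul_assoc,
      ← Finset.mul_sum, ← add_assoc, ih]
    simp only [mul_add, Finset.sum_add_distrib, ← Finset.sum_mul, hp]
    push_cast
    ring

/-- Second moment of a shifted i.i.d. sum of centred terms under the product weights. -/
theorem sum_prod_mul_add_sum_sq {ι : Type*} [Fintype ι] (p f : ι → ℝ) (hp : ∑ t, p t = 1)
    (hf : ∑ t, p t * f t = 0) (m : ℕ) (c : ℝ) :
    ∑ u : Fin m → ι, (∏ i, p (u i)) * (c + ∑ i, f (u i)) ^ 2 =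
      c ^ 2 + m * ∑ t, p t * f t ^ 2 := by
  induction m generalizing c with
  | zero => simp
  | succ m ih =>
    rw [sum_fin_succ_pi]
    simp only [Fin.prod_univ_succ, Fin.sum_univ_succ, Fin.cons_zero, Fin.cons_succ, mul_assoc,
      ← Finset.mul_sum, ← add_assoc, ih]
    have expand (t : ι) : p t * ((c + f t) ^ 2 + m * ∑ s, p s * f s ^ 2) =
        p t * (c ^ 2 + m * ∑ s, p s * f s ^ 2) + 2 * c * (p t * f t) + p t * f t ^ 2 := by
      ring
    simp only [expand, Finset.sum_add_distrib, ← Finset.sum_mul, ← Finset.mul_sum, hp, hf]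
    push_cast
    ring

/-- The variance of the weighted difference estimator is at most `(1/m) ∑ eₜ² / pₜ`. -/
theorem variance_difference_estimator_le {ι : Type*} [Fintype ι] (p e : ι → ℝ)
    (hpos : ∀ t, 0 < p t) (hp : ∑ t, p t = 1) (m : ℕ) (hm : 1 ≤ m) (Q : ℝ)
    (est : (Fin m → ι) → ℝ)
    (hest : ∀ u, est u = Q + (1 / (m : ℝ)) * ∑ i, e (u i) / p (u i)) (μ : ℝ)
    (hμ : μ = ∑ u : Fin m → ι, (∏ i, p (u i)) * est u) :
    ∑ u : Fin m → ι, (∏ i, p (u i)) * (est u - μ) ^ 2 ≤ (∑ t, e t ^ 2 / p t) / m := by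
  have hm0 : (m : ℝ) ≠ 0 := by positivity
  have cancel (t : ι) : p t * (e t / p t) = e t := mul_div_cancel₀ _ (hpos t).ne'
  have hmean : μ = Q + ∑ t, e t := by
    have h := sum_prod_mul_add_sum p (fun t => 1 / (m : ℝ) * (e t / p t)) hp m Q
    simp only [← Finset.mul_sum, mul_left_comm (p _), cancel] at h
    simp only [hest] at hμ
    rw [hμ, h]
    field_simp
  have hdev (u : Fin m → ι) :
      est u - μ = 0 + ∑ i, 1 / (m : ℝ) * (e (u i) / p (u i) - ∑ t, e t) := by
    rw [hest, hmean, ← Finset.mul_sum, Finset.sum_sub_distrib]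
    simp only [Finset.sum_const, Finset.card_univ, Fintype.card_fin, nsmul_eq_mul]
    field_simp
    ring
  have hcentred : ∑ t, p t * (1 / (m : ℝ) * (e t / p t - ∑ s, e s)) = 0 := by
    simp only [mul_left_comm (p _), ← Finset.mul_sum, mul_sub, cancel,
      Finset.sum_sub_distrib, ← Finset.sum_mul, hp]
    ring
  have hsq (t : ι) : p t * (1 / (m : ℝ) * (e t / p t - ∑ s, e s)) ^ 2 =
      1 / (m : ℝ) ^ 2 * (e t ^ 2 / p t - 2 * (∑ s, e s) * e t + p t * (∑ s, e s) ^ 2) := by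
    have := (hpos t).ne'
    field_simp
    ring
  simp only [hdev]
  rw [sum_prod_mul_add_sum_sq p (fun t => 1 / (m : ℝ) * (e t / p t - ∑ s, e s)) hp hcentred]
  simp only [hsq, ← Finset.mul_sum, Finset.sum_add_distrib, Finset.sum_sub_distrib,
    ← Finset.sum_mul, hp]
  have key : (0 : ℝ) ^ 2 + m * (1 / (m : ℝ) ^ 2 * (∑ t, e t ^ 2 / p t -
      2 * (∑ s, e s) * ∑ t, e t + 1 * (∑ s, e s) ^ 2)) =
      (∑ t, e t ^ 2 / p t - (∑ s, e s) ^ 2) / m := by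
    field_simp
    ring
  rw [key]
  gcongr
  nlinarith [sq_nonneg (∑ s, e s)]

/-- Product of the two geometric sums with ratios `exp (-κ)` and `exp κ`. -/
theorem sum_exp_neg_mul_sum_exp_le (T : ℕ) (κ : ℝ) (hκ : 0 < κ) :
    (∑ j : Fin T, Real.exp (-κ * ((j.val : ℝ) + 1))) *
        ∑ j : Fin T, Real.exp (κ * ((j.val : ℝ) + 1)) ≤
      Real.exp κ / (Real.exp κ - 1) ^ 2 * Real.exp (κ * T) := by
  have hgeom (a : ℝ) (ha : Real.exp a ≠ 1) : ∑ j : Fin T, Real.exp (a * ((j.val : ℝ) + 1)) =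
      Real.exp a * ((Real.exp (a * T) - 1) / (Real.exp a - 1)) := by
    rw [Fin.sum_univ_eq_sum_range (fun j : ℕ => Real.exp (a * ((j : ℝ) + 1))),
      mul_comm a (T : ℝ), Real.exp_nat_mul, ← geom_sum_eq ha, Finset.mul_sum]
    refine Finset.sum_congr rfl fun j _ => ?_
    rw [← Real.exp_nat_mul, ← Real.exp_add]
    ring_nf
  have h1 : 1 < Real.exp κ := Real.one_lt_exp_iff.mpr hκ
  have hT1 : 1 ≤ Real.exp (κ * T) := Real.one_le_exp (by positivity)
  rw [hgeom _ (by simpa using hκ.ne'), hgeom _ h1.ne', neg_mul, Real.exp_neg, Real.exp_neg]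
  generalize Real.exp κ = x at *
  generalize Real.exp (κ * T) = y at *
  have hx : x - 1 ≠ 0 := by linarith
  have hx0 : x ≠ 0 := by linarith
  have hy0 : y ≠ 0 := by linarith
  have hfac : x⁻¹ * ((y⁻¹ - 1) / (x⁻¹ - 1)) = (1 - y⁻¹) / (x - 1) := by
    rw [show x⁻¹ - 1 = -((x - 1) / x) by field_simp; ring]
    field_simp
    ring
  have hprod : (1 - y⁻¹) * (y - 1) ≤ y := by
    have : y⁻¹ ≤ 1 := inv_le_one_of_one_le₀ hT1
    have : y⁻¹ * y = 1 := inv_mul_cancel₀ hy0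
    nlinarith
  calc _ = x / (x - 1) ^ 2 * ((1 - y⁻¹) * (y - 1)) := by
        rw [hfac]
        field_simp
    _ ≤ _ := by gcongr


/-- Under exponentially decaying sampling probabilities
`p_t = exp(−κt) / Σ_{j=1}^T exp(−κj)` with `κ > 0`, if `|e_t| ≤ C T^{-3/2}` for
all `t` and some `C > 0`, then the variance of the weighted difference estimator
satisfies `Var(ℓ̂) ≤ (C² e^κ / (m (e^κ − 1)²)) exp(κT) T^{-3}`.
The index `t : Fin T` corresponds to the time point `t.val + 1 ∈ {1,…,T}`. -/
theorem variance_bound_exponential_sampling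
    (T m : ℕ) (hT : 1 ≤ T) (hm : 1 ≤ m)
    (κ : ℝ) (hκ : 0 < κ)
    (ℓ q p : Fin T → ℝ)
    (hp : ∀ t : Fin T, p t = Real.exp (-κ * ((t.val : ℝ) + 1)) /
        ∑ j : Fin T, Real.exp (-κ * ((j.val : ℝ) + 1)))
    (e : Fin T → ℝ) (he : ∀ t, e t = ℓ t - q t)
    (C : ℝ) (hC : 0 < C)
    (hbound : ∀ t, |e t| ≤ C * (T : ℝ) ^ (-(3 : ℝ) / 2))
    (est : (Fin m → Fin T) → ℝ)
    (hest : ∀ u, est u =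
      (∑ t, q t) + (1 / (m : ℝ)) * ∑ i, (ℓ (u i) - q (u i)) / p (u i))
    (μ V : ℝ)
    (hμ : μ = ∑ u : Fin m → Fin T, (∏ i, p (u i)) * est u)
    (hV : V = ∑ u : Fin m → Fin T, (∏ i, p (u i)) * (est u - μ) ^ 2) :
    V ≤ C ^ 2 * Real.exp κ / ((m : ℝ) * (Real.exp κ - 1) ^ 2)
          * Real.exp (κ * T) / (T : ℝ) ^ 3 := by
  have hT0 : (0 : ℝ) < T := by exact_mod_cast hT
  have hm0 : (0 : ℝ) < m := by exact_mod_cast hm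
  have : Nonempty (Fin T) := ⟨⟨0, hT⟩⟩
  set S := ∑ j : Fin T, Real.exp (-κ * ((j.val : ℝ) + 1)) with hS
  have hSpos : 0 < S := Finset.sum_pos (fun _ _ => Real.exp_pos _) Finset.univ_nonempty
  have hpos (t : Fin T) : 0 < p t := by
    rw [hp]
    positivity
  have hsum : ∑ t, p t = 1 := by
    simp only [hp, ← Finset.sum_div, ← hS]
    exact div_self hSpos.ne'
  have hvar := variance_difference_estimator_le p e hpos hsum m hm (∑ t, q t) est
    (by simpa only [he] using hest) μ hμ
  rw [← hV] at hvar
  have hrate : ((T : ℝ) ^ (-(3 : ℝ) / 2)) ^ 2 = 1 / (T : ℝ) ^ 3 := by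
    rw [← Real.rpow_natCast, ← Real.rpow_mul hT0.le,
      show -(3 : ℝ) / 2 * ((2 : ℕ) : ℝ) = -((3 : ℕ) : ℝ) by norm_num,
      Real.rpow_neg hT0.le, Real.rpow_natCast, one_div]
  have hterm (t : Fin T) :
      e t ^ 2 / p t ≤ C ^ 2 / (T : ℝ) ^ 3 * (S * Real.exp (κ * ((t.val : ℝ) + 1))) := by
    have hesq : e t ^ 2 ≤ C ^ 2 / (T : ℝ) ^ 3 := by
      rw [← sq_abs, div_eq_mul_one_div (C ^ 2), ← hrate, ← mul_pow]
      exact pow_le_pow_left₀ (abs_nonneg _) (hbound t) 2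
    have hinv : e t ^ 2 / p t = e t ^ 2 * (S * Real.exp (κ * ((t.val : ℝ) + 1))) := by
      rw [hp, neg_mul, Real.exp_neg]
      field_simp
    rw [hinv]
    gcongr
  calc V ≤ (∑ t, e t ^ 2 / p t) / m := hvar
    _ ≤ (∑ t : Fin T, C ^ 2 / (T : ℝ) ^ 3 * (S * Real.exp (κ * ((t.val : ℝ) + 1)))) / m := by
        gcongr with t
        exact hterm t
    _ = C ^ 2 / (T : ℝ) ^ 3 * (S * ∑ t : Fin T, Real.exp (κ * ((t.val : ℝ) + 1))) / m := by
        simp only [← Finset.mul_sum]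
    _ ≤ C ^ 2 / (T : ℝ) ^ 3 *
          (Real.exp κ / (Real.exp κ - 1) ^ 2 * Real.exp (κ * T)) / m := by
        have := sum_exp_neg_mul_sum_exp_le T κ hκ
        exact div_le_div_of_nonneg_right
          (mul_le_mul_of_nonneg_left this (by positivity)) hm0.le
    _ = _ := by
        simp only [div_eq_mul_inv, mul_inv]
        ring
end

section
/- Suppose the control variate residuals are homogeneous, e_t = ē for all t = 1,…,T with ē ≠ 0, and suppose t* ≥ 2. Define the tail contribution to the variance of the weighted difference estimator under TPD probabilities with decay parameter γ as V_𝒯(γ) = (ē²/m) Σ_{t=t*+1}^{T} (1 − T p_t(γ))² / p_t(γ), where p_t(γ) = ε(γ)/(T−t*) for t in the tail. Then for any 0 ≤ γ₁ < γ₂ one has V_𝒯(γ₁) < V_𝒯(γ₂). -/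
/-- With `q = p⁻¹`, the summand `(1 - c p)² / p` is strictly increasing in `q` on `[c, ∞)`. -/
lemma one_sub_mul_inv_sq_div_inv_lt {c x y : ℝ} (hc : 0 < c) (hx : c ≤ x) (hxy : x < y) :
    (1 - c * x⁻¹) ^ 2 / x⁻¹ < (1 - c * y⁻¹) ^ 2 / y⁻¹ := by
  have hx0 : 0 < x := hc.trans_le hx
  have hy0 : 0 < y := hx0.trans hxy
  have key : ∀ z : ℝ, 0 < z → (1 - c * z⁻¹) ^ 2 / z⁻¹ = (z - c) ^ 2 / z := by
    intro z hz
    field_simp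
  rw [key x hx0, key y hy0, div_lt_div_iff₀ hx0 hy0]
  have hprod : c * c < x * y := by nlinarith
  nlinarith [mul_pos (sub_pos.2 hxy) (sub_pos.2 hprod)]

/-- The sum of the ratios `((n + b) / (j + b)) ^ γ` over the head is strictly increasing in `γ`. -/
lemma sum_div_rpow_strictMono {n : ℕ} (hn : 2 ≤ n) {b : ℝ} (hb : 0 ≤ b) :
    StrictMono fun γ : ℝ => ∑ j ∈ Finset.Icc 1 n, (((n : ℝ) + b) / ((j : ℝ) + b)) ^ γ := by
  intro γ₁ γ₂ h
  refine Finset.sum_lt_sum (fun j hj => ?_) ⟨1, Finset.mem_Icc.2 ⟨le_rfl, by omega⟩, ?_⟩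
  · obtain ⟨hj1, hjn⟩ := Finset.mem_Icc.1 hj
    have hj1' : (1 : ℝ) ≤ j := by exact_mod_cast hj1
    have hjn' : (j : ℝ) ≤ n := by exact_mod_cast hjn
    refine Real.rpow_le_rpow_of_exponent_le ?_ h.le
    rw [one_le_div (by linarith)]
    linarith
  · have hn' : (2 : ℝ) ≤ n := by exact_mod_cast hn
    refine Real.rpow_lt_rpow_of_exponent_lt ?_ h
    rw [Nat.cast_one, one_lt_div (by linarith)]
    linarith

/-- The reciprocal form of the tail sampling probability. -/
lemma tail_prob_eq_inv {n : ℕ} (hn : 1 ≤ n) {b : ℝ} (hb : 0 ≤ b) {N : ℝ} (hN : 0 < N) (γ : ℝ) :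
    ((n : ℝ) + b) ^ (-γ) * N /
        (((n : ℝ) + b) ^ (-γ) * N + ∑ j ∈ Finset.Icc 1 n, ((j : ℝ) + b) ^ (-γ)) / N =
      (N + ∑ j ∈ Finset.Icc 1 n, (((n : ℝ) + b) / ((j : ℝ) + b)) ^ γ)⁻¹ := by
  have hn' : (1 : ℝ) ≤ n := by exact_mod_cast hn
  have ha : 0 < (n : ℝ) + b := by linarith
  have hA : 0 < ((n : ℝ) + b) ^ (-γ) := Real.rpow_pos_of_pos ha _
  have hsum : ∑ j ∈ Finset.Icc 1 n, ((j : ℝ) + b) ^ (-γ) =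
      ((n : ℝ) + b) ^ (-γ) *
        ∑ j ∈ Finset.Icc 1 n, (((n : ℝ) + b) / ((j : ℝ) + b)) ^ γ := by
    rw [Finset.mul_sum]
    refine Finset.sum_congr rfl fun j _ => ?_
    have hj : 0 ≤ (j : ℝ) + b := by positivity
    rw [Real.div_rpow ha.le hj, Real.rpow_neg hj, Real.rpow_neg ha.le]
    have := (Real.rpow_pos_of_pos ha γ).ne'
    field_simp
  have hR : 0 ≤ ∑ j ∈ Finset.Icc 1 n, (((n : ℝ) + b) / ((j : ℝ) + b)) ^ γ :=
    Finset.sum_nonneg fun j _ => by positivity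
  rw [hsum, ← mul_add, mul_div_mul_left _ _ hA.ne', div_right_comm, div_self hN.ne', one_div]


/-- Under homogeneous control variate residuals `e_t = ē ≠ 0` and
`t* ≥ 2`, the tail contribution
`V_𝒯(γ) = (ē²/m) Σ_{t=t*+1}^T (1 − T p_t(γ))² / p_t(γ)` (with
`p_t(γ) = ε(γ)/(T−t*)` on the tail) to the variance of the weighted difference
estimator is strictly increasing in the decay parameter: `0 ≤ γ₁ < γ₂` implies
`V_𝒯(γ₁) < V_𝒯(γ₂)`. -/
theorem tail_variance_strictly_increasing
    (tstar T m : ℕ) (h2 : 2 ≤ tstar) (hlt : tstar < T) (hm : 1 ≤ m)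
    (b : ℝ) (hb : 0 ≤ b)
    (ebar : ℝ) (hebar : ebar ≠ 0)
    (ε : ℝ → ℝ)
    (hε : ∀ γ : ℝ, ε γ =
      ((tstar : ℝ) + b) ^ (-γ) * ((T : ℝ) - tstar) /
        (((tstar : ℝ) + b) ^ (-γ) * ((T : ℝ) - tstar)
          + ∑ j ∈ Finset.Icc 1 tstar, ((j : ℝ) + b) ^ (-γ)))
    (V : ℝ → ℝ)
    (hV : ∀ γ : ℝ, V γ = ebar ^ 2 / (m : ℝ) *
      ∑ _t ∈ Finset.Icc (tstar + 1) T,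
        (1 - (T : ℝ) * (ε γ / ((T : ℝ) - tstar))) ^ 2 / (ε γ / ((T : ℝ) - tstar))) :
    ∀ γ₁ γ₂ : ℝ, 0 ≤ γ₁ → γ₁ < γ₂ → V γ₁ < V γ₂ := by
  intro γ₁ γ₂ h0 h
  have hN : 0 < (T : ℝ) - tstar := sub_pos.2 (by exact_mod_cast hlt)
  have hT : (0 : ℝ) < T := by exact_mod_cast (by omega : 0 < T)
  have hmono := sum_div_rpow_strictMono h2 hb
  have hle : (tstar : ℝ) ≤
      ∑ j ∈ Finset.Icc 1 tstar, (((tstar : ℝ) + b) / ((j : ℝ) + b)) ^ γ₁ := by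
    simpa using hmono.monotone h0
  have hm' : (0 : ℝ) < m := by exact_mod_cast hm
  rw [hV, hV, hε, hε, tail_prob_eq_inv (by omega) hb hN, tail_prob_eq_inv (by omega) hb hN]
  refine mul_lt_mul_of_pos_left ?_ (by positivity)
  refine Finset.sum_lt_sum_of_nonempty (Finset.nonempty_Icc.2 hlt) fun _ _ => ?_
  exact one_sub_mul_inv_sq_div_inv_lt hT (by linarith) (by linarith [hmono h])
end

section
/- Let 0 < c ≤ 1 and suppose p_t ≥ c/T for all t = 1,…,T. Assume e = Σ_{t=1}^T e_t ≠ 0 and that the e_t are not all equal. Set ρ = e² / (T Σ_{t=1}^T e_t²). Then ρ ∈ (0,1), and the ratio of the variance of the weighted difference estimator with probabilities (p_t) to the variance of the difference estimator with uniform probabilities (p_t = 1/T) satisfies [Σ_{t=1}^T e_t²/p_t − e²] / [T Σ_{t=1}^T e_t² − e²] ≤ (1/c − ρ)/(1 − ρ). -/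
/-- The strict Cauchy–Schwarz inequality against the constant function, for a nonconstant family. -/
theorem sq_sum_lt_card_mul_sum_sq {ι : Type*} [Fintype ι] (f : ι → ℝ)
    (hf : ∃ i j, f i ≠ f j) :
    (∑ i, f i) ^ 2 < (Fintype.card ι : ℝ) * ∑ i, f i ^ 2 := by
  obtain ⟨i, j, hij⟩ := hf
  set n : ℝ := (Fintype.card ι : ℝ) with hn
  set a := ∑ i, f i with ha
  have hn0 : 0 < n := Nat.cast_pos.2 (Fintype.card_pos_iff.2 ⟨i⟩)
  have hpos : 0 < ∑ k, (n * f k - a) ^ 2 := by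
    obtain ⟨k, hk⟩ : ∃ k, n * f k - a ≠ 0 := by
      by_contra! h
      exact hij (mul_left_cancel₀ hn0.ne' (by linarith [h i, h j]))
    exact Finset.sum_pos' (fun _ _ => sq_nonneg _) ⟨k, Finset.mem_univ k, by positivity⟩
  have hexp : ∑ k, (n * f k - a) ^ 2 = n * (n * ∑ k, f k ^ 2 - a ^ 2) := by
    have hterm (k : ι) : (n * f k - a) ^ 2 = n ^ 2 * f k ^ 2 - 2 * n * a * f k + a ^ 2 := by ring
    simp only [hterm, Finset.sum_add_distrib, Finset.sum_sub_distrib, ← Finset.mul_sum,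
      Finset.sum_const, Finset.card_univ, nsmul_eq_mul, ← hn, ← ha]
    ring
  rw [hexp] at hpos
  linarith [pos_of_mul_pos_right hpos hn0.le]

/-- If the weights are bounded below by `a`, then the weighted sum of squares is at most `1 / a`
times the unweighted one. -/
theorem sum_sq_div_le {ι : Type*} [Fintype ι] (f p : ι → ℝ) {a : ℝ} (ha : 0 < a)
    (hp : ∀ i, a ≤ p i) :
    ∑ i, f i ^ 2 / p i ≤ (∑ i, f i ^ 2) / a := by
  rw [Finset.sum_div]
  exact Finset.sum_le_sum fun i _ => div_le_div_of_nonneg_left (sq_nonneg _) ha (hp i)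


/-- Let `0 < c ≤ 1` and `p_t ≥ c/T` for all `t`.  If
`e = Σ e_t ≠ 0` and the `e_t` are not all equal, then
`ρ = e²/(T Σ e_t²) ∈ (0,1)` and the variance ratio of the weighted difference
estimator to the uniform difference estimator satisfies
`(Σ e_t²/p_t − e²)/(T Σ e_t² − e²) ≤ (1/c − ρ)/(1 − ρ)`. -/
theorem variance_inflation_bound
    (T : ℕ) (hT : 1 ≤ T)
    (e p : Fin T → ℝ)
    (c : ℝ) (hc0 : 0 < c) (hc1 : c ≤ 1)
    (hfloor : ∀ t, c / (T : ℝ) ≤ p t)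
    (hpsum : ∑ t, p t = 1)
    (hesum : (∑ t, e t) ≠ 0)
    (hne : ∃ s t : Fin T, e s ≠ e t)
    (ρ : ℝ) (hρ : ρ = (∑ t, e t) ^ 2 / ((T : ℝ) * ∑ t, (e t) ^ 2)) :
    (0 < ρ ∧ ρ < 1) ∧
    ((∑ t, (e t) ^ 2 / p t) - (∑ t, e t) ^ 2) /
        ((T : ℝ) * (∑ t, (e t) ^ 2) - (∑ t, e t) ^ 2)
      ≤ (1 / c - ρ) / (1 - ρ) := by
  have hT0 : (0 : ℝ) < T := by exact_mod_cast hT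
  have hlt : (∑ t, e t) ^ 2 < (T : ℝ) * ∑ t, (e t) ^ 2 := by
    simpa using sq_sum_lt_card_mul_sum_sq e hne
  have hsum := sum_sq_div_le e p (div_pos hc0 hT0) hfloor
  have he : 0 < (∑ t, e t) ^ 2 := by positivity
  have hA : 0 < (T : ℝ) * ∑ t, (e t) ^ 2 := he.trans hlt
  have hρ1 : ρ < 1 := by rwa [hρ, div_lt_one hA]
  refine ⟨⟨hρ ▸ div_pos he hA, hρ1⟩, ?_⟩
  have hmul : ρ * ((T : ℝ) * ∑ t, (e t) ^ 2) = (∑ t, e t) ^ 2 := by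
    rw [hρ, div_mul_cancel₀ _ hA.ne']
  have hratio : (1 / c - ρ) / (1 - ρ) =
      ((∑ t, (e t) ^ 2) / (c / T) - (∑ t, e t) ^ 2) /
        ((T : ℝ) * (∑ t, (e t) ^ 2) - (∑ t, e t) ^ 2) := by
    rw [div_eq_div_iff (sub_pos.2 hρ1).ne' (sub_pos.2 hlt).ne', ← hmul]
    field_simp
  rw [hratio]
  exact div_le_div_of_nonneg_right (sub_le_sub_right hsum _) (sub_pos.2 hlt).le
end

section
/- Assume t* ≥ 2 and γ > 0 in the truncated power-law decaying scheme. Then the computational-cost bound under TPD is strictly smaller than the corresponding bound under uniform sampling: t* + (T − t*)(1 − (1 − ε(γ))^m) < t* + (T − t*)(1 − (t*/T)^m) for every integer m ≥ 1, where the right-hand side is the bound obtained by substituting the uniform-sampling tail mass ε = (T − t*)/T. -/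
/-- The head mass of a truncated power law strictly exceeds the mass obtained by giving each of
the `n ≥ 2` head indices the weight of the last one. -/
theorem mul_rpow_neg_lt_sum_Icc {n : ℕ} (hn : 2 ≤ n) {b γ : ℝ} (hb : 0 ≤ b) (hγ : 0 < γ) :
    (n : ℝ) * ((n : ℝ) + b) ^ (-γ) < ∑ j ∈ Finset.Icc 1 n, ((j : ℝ) + b) ^ (-γ) := by
  have hconst : (n : ℝ) * ((n : ℝ) + b) ^ (-γ) =
      ∑ _j ∈ Finset.Icc 1 n, ((n : ℝ) + b) ^ (-γ) := by simp
  rw [hconst]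
  refine Finset.sum_lt_sum (fun j hj => ?_) ⟨1, Finset.mem_Icc.mpr ⟨le_rfl, by omega⟩, ?_⟩
  · obtain ⟨h1, hjn⟩ := Finset.mem_Icc.mp hj
    have h1' : (1 : ℝ) ≤ j := by exact_mod_cast h1
    have hjn' : (j : ℝ) ≤ n := by exact_mod_cast hjn
    exact Real.rpow_le_rpow_of_nonpos (by linarith) (by linarith) (by linarith)
  · have hn' : (2 : ℝ) ≤ n := by exact_mod_cast hn
    exact Real.rpow_lt_rpow_of_neg (by push_cast; linarith) (by push_cast; linarith) (by linarith)

/-- If the head mass `S` exceeds `t * A`, then the normalized tail mass `A * (T - t)` leaves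
a head fraction larger than `t / T`. -/
theorem div_lt_one_sub_tail_mass {t T A S : ℝ} (ht : 0 < t) (htT : t < T) (hA : 0 < A)
    (hS : t * A < S) : t / T < 1 - A * (T - t) / (A * (T - t) + S) := by
  have hd : 0 < T - t := sub_pos.mpr htT
  have hS0 : 0 < S := (mul_pos ht hA).trans hS
  have hden : 0 < A * (T - t) + S := by positivity
  rw [one_sub_div hden.ne', div_lt_div_iff₀ (ht.trans htT) hden]
  nlinarith [mul_lt_mul_of_pos_right hS hd]

/-- Assume `t* ≥ 2` and `γ > 0` in the truncated power-law
decaying scheme.  Then the computational-cost bound under TPD is strictly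
smaller than the corresponding bound under uniform sampling:
`t* + (T − t*)(1 − (1 − ε(γ))^m) < t* + (T − t*)(1 − (t*/T)^m)` for every
integer `m ≥ 1` (the right-hand side corresponding to the uniform-sampling tail
mass `ε = (T − t*)/T`). -/
theorem tpd_cost_bound_lt_uniform
    (tstar T : ℕ) (h2 : 2 ≤ tstar) (hlt : tstar < T)
    (b : ℝ) (hb : 0 ≤ b)
    (γ : ℝ) (hγ : 0 < γ)
    (ε : ℝ → ℝ)
    (hε : ∀ γ' : ℝ, ε γ' =
      ((tstar : ℝ) + b) ^ (-γ') * ((T : ℝ) - tstar) /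
        (((tstar : ℝ) + b) ^ (-γ') * ((T : ℝ) - tstar)
          + ∑ j ∈ Finset.Icc 1 tstar, ((j : ℝ) + b) ^ (-γ'))) :
    ∀ m : ℕ, 1 ≤ m →
      (tstar : ℝ) + ((T : ℝ) - tstar) * (1 - (1 - ε γ) ^ m)
        < (tstar : ℝ) + ((T : ℝ) - tstar) * (1 - ((tstar : ℝ) / T) ^ m) := by
  intro m hm
  have ht : (0 : ℝ) < tstar := by exact_mod_cast (by omega : 0 < tstar)
  have htT : (tstar : ℝ) < T := by exact_mod_cast hlt
  have hhead : (tstar : ℝ) / T < 1 - ε γ := by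
    rw [hε γ]
    exact div_lt_one_sub_tail_mass ht htT (Real.rpow_pos_of_pos (by linarith) _)
      (mul_rpow_neg_lt_sum_Icc h2 hb hγ)
  have hpow : ((tstar : ℝ) / T) ^ m < (1 - ε γ) ^ m :=
    pow_lt_pow_left₀ hhead (by positivity) (by omega)
  have hd : (0 : ℝ) < (T : ℝ) - tstar := sub_pos.mpr htT
  gcongr
end
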